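/- Let E be a directed graph, let d_r be a Drinen range-vector for E, and let {s_f, p_w} be a Cuntz-Krieger d_r(E)-family in a C*-algebra A. Define Q_v = p_{v_0} for v ∈ E^0 and T_e = s_e s_{f(r(e))_{d_r(e)}} ⋯ s_{f(r(e))_1} for e ∈ E^1 (T_e = s_e when d_r(e) = 0). Then for all finite paths μ, ν in d_r(E) such that the source of μ is v_0 and the source of ν is w_0 for some v, w ∈ E^0 and r(μ) = r(ν), the element s_μ s_ν^* (where s_μ denotes the product s_{μ_1} ⋯ s_{μ_n} over the edges of μ, and s_μ = p_{v_0} for the empty path at v_0) lies in C*(T_e, Q_v), the smallest norm-closed star-subalgebra of A containing all T_e and Q_v. -/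

import Mathlib

/-! Statement 4: An in-delay of a directed graph sends Cuntz-Krieger families of the
in-delayed graph to Cuntz-Krieger families of the original graph. -/

/-- A Cuntz-Krieger family for the directed graph with vertex type `V`, edge type `E`,
range map `r` and source map `s`, inside a C*-algebra `A`.  The relation
`S e S e* ≤ P (s e)` is phrased algebraically (for projections `p ≤ q ↔ p * q = p`). -/
structure CKFamily {A : Type} [NonUnitalCStarAlgebra A] {V E : Type}
    (r s : E → V) (S : E → A) (P : V → A) : Prop where
  partialIsom : ∀ e, S e * star (S e) * S e = S e
  orthoRanges : ∀ e f, e ≠ f → (S e * star (S e)) * (S f * star (S f)) = 0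
  projIdem : ∀ v, P v * P v = P v
  projSelfAdj : ∀ v, star (P v) = P v
  orthoProj : ∀ v w, v ≠ w → P v * P w = 0
  ck1 : ∀ e, star (S e) * S e = P (r e)
  ck2 : ∀ e, (S e * star (S e)) * P (s e) = S e * star (S e)
  ck3 : ∀ v, {e | s e = v}.Nonempty → {e | s e = v}.Finite →
      P v = ∑ᶠ e ∈ {e | s e = v}, S e * star (S e)

section InDelay

variable {V E : Type} (r s : E → V) (d : V → ℕ∞) (dE : E → ℕ)

/-- Vertices of the in-delayed graph `d_r(E)`: pairs `v_i = (v, i)` with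
`0 ≤ i ≤ d_r v`. -/
def IDVert : Type := {p : V × ℕ // (p.2 : ℕ∞) ≤ d p.1}

/-- Edges of the in-delayed graph: the original edges `e ∈ E^1` together with the
delay edges `f(v)_i`, `1 ≤ i ≤ d_r v`, encoded as pairs `(v, i)`. -/
def IDEdge (E : Type) {V : Type} (d : V → ℕ∞) : Type :=
  E ⊕ {p : V × ℕ // 1 ≤ p.2 ∧ (p.2 : ℕ∞) ≤ d p.1}

/-- The vertex `v_0` of the in-delayed graph. -/
def idVert0 (v : V) : IDVert d := ⟨(v, 0), by simp⟩

/-- The source map of the in-delayed graph: `s(e) = s(e)_0` and `s(f(v)_i) = v_i`. -/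
def idSrc : IDEdge E d → IDVert d
  | .inl e => idVert0 d (s e)
  | .inr g => ⟨g.1, g.2.2⟩

/-- The range map of the in-delayed graph: `r(e) = r(e)_{d_r e}` and
`r(f(v)_i) = v_{i-1}`.  (The hypothesis `hrd`, that `d_r e ≤ d_r (r e)`, is a
consequence of the definition of a Drinen range-vector.) -/
def idRng (hrd : ∀ e, (dE e : ℕ∞) ≤ d (r e)) : IDEdge E d → IDVert d
  | .inl e => ⟨(r e, dE e), hrd e⟩
  | .inr g => ⟨(g.1.1, g.1.2 - 1), le_trans (by exact_mod_cast Nat.sub_le _ _) g.2.2⟩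

variable {A : Type} [Mul A]

/-- `chainL g x n = x * g n * g (n-1) * ⋯ * g 1` (and `chainL g x 0 = x`). -/
def chainL (g : ℕ → A) : A → ℕ → A
  | x, 0 => x
  | x, n + 1 => chainL g (x * g (n + 1)) n

end InDelay

section InDelayFamily

variable {V E : Type} (r s : E → V) (d : V → ℕ∞) (dE : E → ℕ)
variable {A : Type} [NonUnitalCStarAlgebra A]

open scoped Classical in
/-- `T_e = s_e * s_{f(r e)_{d_r e}} ⋯ s_{f(r e)_1}` (and `T_e = s_e` when `d_r e = 0`). -/
noncomputable def TID (S : IDEdge E d → A) (e : E) : A :=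
  chainL
    (fun k => if h : 1 ≤ k ∧ (k : ℕ∞) ≤ d (r e) then S (.inr ⟨(r e, k), h⟩) else 0)
    (S (.inl e)) (dE e)

/-- `Q_v = p_{v_0}`. -/
noncomputable def QID (P : IDVert d → A) (v : V) : A := P (idVert0 d v)

end InDelayFamily

/-- `IsPath r s a b es` says that the list of edges `es` is a finite path from the
vertex `a` to the vertex `b` (consecutive edges compose, `r μᵢ = s μᵢ₊₁`); the empty
list is the path of length zero at `a = b`. -/
inductive IsPath {V' E' : Type} (rM sM : E' → V') : V' → V' → List E' → Prop
  | nil (v : V') : IsPath rM sM v v []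
  | cons (e : E') (w : V') (es : List E') :
      IsPath rM sM (rM e) w es → IsPath rM sM (sM e) w (e :: es)

/-- `s_μ`: the product `s_{μ₁} ⋯ s_{μₙ}` over the edges of a path `μ`, with
`s_μ = p_v` for the empty path at `v`. -/
def pathElt {A : Type} [Mul A] {V' E' : Type} (S : E' → A) (P : V' → A) :
    V' → List E' → A
  | v, [] => P v
  | _, [e] => S e
  | v, e :: f :: es => S e * pathElt S P v (f :: es)

theorem chainL_mul {A : Type} [Semigroup A] (g : ℕ → A) (y x : A) (n : ℕ) :
    chainL g (y * x) n = y * chainL g x n := by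
  induction n generalizing x with
  | zero => rfl
  | succ n ih => simp only [chainL, mul_assoc, ih]

namespace CKFamily

variable {A : Type} [NonUnitalCStarAlgebra A] {V E : Type} {r s : E → V} {S : E → A} {P : V → A}

theorem mul_proj_range (h : CKFamily r s S P) (e : E) : S e * P (r e) = S e := by
  rw [← h.ck1, ← mul_assoc, h.partialIsom]

theorem proj_source_mul (h : CKFamily r s S P) (e : E) : P (s e) * S e = S e := by
  have key : P (s e) * (S e * star (S e)) = S e * star (S e) := by
    simpa [h.projSelfAdj] using congrArg star (h.ck2 e)
  rw [← h.partialIsom e, ← mul_assoc, key]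

theorem proj_eq_of_unique (h : CKFamily r s S P) (e : E) (he : ∀ f, s f = s e → f = e) :
    P (s e) = S e * star (S e) := by
  have hs : {f | s f = s e} = {e} := by
    ext f
    exact ⟨he f, fun hf => congrArg s hf⟩
  have := h.ck3 (s e) ⟨e, rfl⟩ (hs ▸ Set.finite_singleton e)
  rwa [hs, finsum_mem_singleton] at this

theorem pathElt_cons (h : CKFamily r s S P) (a : V) (e : E) (es : List E) :
    pathElt S P a (e :: es) = S e * pathElt S P (r e) es := by
  cases es with
  | nil => exact (h.mul_proj_range e).symm
  | cons f fs =>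
    have indep : ∀ (gs : List E) (f : E) (b c : V),
        pathElt S P b (f :: gs) = pathElt S P c (f :: gs) := by
      intro gs
      induction gs with
      | nil => intros; rfl
      | cons g gs ih => intro f b c; exact congrArg (S f * ·) (ih g b c)
    exact congrArg (S e * ·) (indep fs f a (r e))

theorem pathElt_mul_proj (h : CKFamily r s S P) {a c : V} {es : List E} (hp : IsPath r s a c es) :
    pathElt S P a es * P c = pathElt S P a es := by
  induction hp with
  | nil v => exact h.projIdem v
  | cons e w es _ ih => rw [h.pathElt_cons, mul_assoc, ih]

end CKFamily

section Delay

variable {A : Type} [NonUnitalCStarAlgebra A] {V E : Type} {r s : E → V}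
  {d : V → ℕ∞} {dE : E → ℕ}

/-- The edge of the in-delayed graph given by an edge of the original graph. -/
def IDEdge.orig (e : E) : IDEdge E d := .inl e

/-- The edge of the in-delayed graph given by the delay edge `f(v)_i`. -/
def IDEdge.delay (g : {p : V × ℕ // 1 ≤ p.2 ∧ (p.2 : ℕ∞) ≤ d p.1}) : IDEdge E d := .inr g

open scoped Classical in
/-- The partial isometry of the delay edge `f(v)_k`, and `0` when there is no such edge. -/
noncomputable def delayElt (S : IDEdge E d → A) (v : V) (k : ℕ) : A :=
  if h : 1 ≤ k ∧ (k : ℕ∞) ≤ d v then S (.delay ⟨(v, k), h⟩) else 0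

/-- The element of the path `f(v)_i ⋯ f(v)_1` from the vertex `v_i` down to `v_0`. -/
noncomputable def descentElt (S : IDEdge E d → A) (P : IDVert d → A) (c : IDVert d) : A :=
  chainL (delayElt S c.1.1) (P c) c.1.2

variable {hrd : ∀ e, (dE e : ℕ∞) ≤ d (r e)} {S : IDEdge E d → A} {P : IDVert d → A}

theorem descentElt_delay (h : CKFamily (idRng r d dE hrd) (idSrc s d) S P)
    (g : {p : V × ℕ // 1 ≤ p.2 ∧ (p.2 : ℕ∞) ≤ d p.1}) :
    descentElt S P (idSrc s d (.delay g)) =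
      S (.delay g) * descentElt S P (idRng r d dE hrd (.delay g)) := by
  obtain ⟨⟨v, k⟩, hk⟩ := g
  obtain ⟨n, rfl⟩ : ∃ n, k = n + 1 := ⟨k - 1, (Nat.sub_add_cancel hk.1).symm⟩
  have hg : delayElt S v (n + 1) = S (.delay ⟨(v, n + 1), hk⟩) := dif_pos hk
  change chainL (delayElt S v) (P (idSrc s d (.delay ⟨(v, n + 1), hk⟩)) * delayElt S v (n + 1)) n =
    S (.delay ⟨(v, n + 1), hk⟩) *
      chainL (delayElt S v) (P (idRng r d dE hrd (.delay ⟨(v, n + 1), hk⟩))) n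
  rw [hg, h.proj_source_mul, ← chainL_mul, h.mul_proj_range]

theorem mul_descentElt (h : CKFamily (idRng r d dE hrd) (idSrc s d) S P) (e : E) :
    S (.orig e) * descentElt S P (idRng r d dE hrd (.orig e)) = TID r d dE S e := by
  change S (.orig e) * chainL (delayElt S (r e)) (P (idRng r d dE hrd (.orig e))) (dE e) =
    chainL (delayElt S (r e)) (S (.orig e)) (dE e)
  rw [← chainL_mul, h.mul_proj_range]

theorem descentElt_mul_star (h : CKFamily (idRng r d dE hrd) (idSrc s d) S P) (c : IDVert d) :
    descentElt S P c * star (descentElt S P c) = P c := by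
  obtain ⟨⟨v, n⟩, hn⟩ := c
  induction n with
  | zero =>
    change P (idVert0 d v) * star (P (idVert0 d v)) = P (idVert0 d v)
    rw [h.projSelfAdj, h.projIdem]
  | succ n ih =>
    let g : {p : V × ℕ // 1 ≤ p.2 ∧ (p.2 : ℕ∞) ≤ d p.1} := ⟨(v, n + 1), Nat.le_add_left 1 n, hn⟩
    have hr := ih (idRng r d dE hrd (.delay g)).2
    change descentElt S P (idRng r d dE hrd (.delay g)) *
      star (descentElt S P (idRng r d dE hrd (.delay g))) = P (idRng r d dE hrd (.delay g)) at hr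
    have hu : ∀ f, idSrc s d f = idSrc s d (.delay g) → f = .delay g := by
      rintro (e | g') hf
      · exact absurd (congrArg (fun c : IDVert d => c.1.2) hf) (Nat.succ_ne_zero n).symm
      · exact congrArg Sum.inr (Subtype.ext (congrArg (fun c : IDVert d => c.1) hf))
    change descentElt S P (idSrc s d (.delay g)) * star (descentElt S P (idSrc s d (.delay g))) =
      P (idSrc s d (.delay g))
    rw [descentElt_delay h, star_mul, mul_assoc, ← mul_assoc (descentElt S P _), hr,
      ← mul_assoc, h.mul_proj_range, ← h.proj_eq_of_unique _ hu]

theorem exists_pathElt_mul_descentElt (h : CKFamily (idRng r d dE hrd) (idSrc s d) S P)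
    {a c : IDVert d} {μ : List (IDEdge E d)}
    (hp : IsPath (idRng r d dE hrd) (idSrc s d) a c μ) :
    ∃ m ∈ NonUnitalStarAlgebra.adjoin ℂ (Set.range (TID r d dE S) ∪ Set.range (QID d P)),
      pathElt S P a μ * descentElt S P c = descentElt S P a * m := by
  induction hp with
  | nil c =>
    refine ⟨QID d P c.1.1, NonUnitalStarAlgebra.subset_adjoin ℂ _ (.inr ⟨_, rfl⟩), ?_⟩
    have hl : P c * descentElt S P c = descentElt S P c := by
      rw [descentElt, ← chainL_mul, h.projIdem]
    refine hl.trans ?_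
    obtain ⟨⟨v, n⟩, hn⟩ := c
    clear hl
    induction n with
    | zero => exact (h.projIdem _).symm
    | succ n ih =>
      let g : {p : V × ℕ // 1 ≤ p.2 ∧ (p.2 : ℕ∞) ≤ d p.1} := ⟨(v, n + 1), Nat.le_add_left 1 n, hn⟩
      have hr := ih (idRng r d dE hrd (.delay g)).2
      change descentElt S P (idSrc s d (.delay g)) = descentElt S P (idSrc s d (.delay g)) * QID d P v
      rw [descentElt_delay h, mul_assoc]
      exact congrArg _ hr
  | cons e w es _ ih =>
    obtain ⟨m, hm, hmul⟩ := ih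
    rw [h.pathElt_cons, mul_assoc, hmul, ← mul_assoc]
    rcases e with e | g
    · change ∃ m' ∈ _, S (.orig e) * descentElt S P (idRng r d dE hrd (.orig e)) * m =
        descentElt S P (idSrc s d (.orig e)) * m'
      refine ⟨TID r d dE S e * m,
        mul_mem (NonUnitalStarAlgebra.subset_adjoin ℂ _ (.inl ⟨e, rfl⟩)) hm, ?_⟩
      have hd : descentElt S P (idSrc s d (.orig e)) = P (idSrc s d (.orig e)) := rfl
      rw [hd, ← mul_descentElt h, ← mul_assoc, ← mul_assoc, h.proj_source_mul]
    · exact ⟨m, hm, congrArg (· * m) (descentElt_delay h g).symm⟩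

theorem pathElt_mul_descentElt_mem (h : CKFamily (idRng r d dE hrd) (idSrc s d) S P)
    {v : V} {c : IDVert d} {μ : List (IDEdge E d)}
    (hp : IsPath (idRng r d dE hrd) (idSrc s d) (idVert0 d v) c μ) :
    pathElt S P (idVert0 d v) μ * descentElt S P c ∈
      NonUnitalStarAlgebra.adjoin ℂ (Set.range (TID r d dE S) ∪ Set.range (QID d P)) := by
  obtain ⟨m, hm, hmul⟩ := exists_pathElt_mul_descentElt h hp
  rw [hmul]
  exact mul_mem (NonUnitalStarAlgebra.subset_adjoin ℂ _ (.inr ⟨v, rfl⟩)) hm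

end Delay

/-- Let `E` be a directed graph, `d_r` a Drinen range-vector and
`{s_f, p_w}` a Cuntz-Krieger `d_r(E)`-family in a C*-algebra `A`.  With `Q_v = p_{v_0}`
and `T_e = s_e s_{f(r e)_{d_r e}} ⋯ s_{f(r e)_1}`, every element `s_μ s_ν^*`, for
finite paths `μ, ν` of `d_r(E)` with sources of the form `v_0`, `w_0` and common range,
lies in `C*(T_e, Q_v)`, the smallest norm-closed star-subalgebra of `A` containing all
the `T_e` and `Q_v`. -/
theorem indelay_corner_mem {A : Type} [NonUnitalCStarAlgebra A]
    {V E : Type} [Countable V] [Countable E] (r s : E → V)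
    (d : V → ℕ∞) (dE : E → ℕ)
    (hsup : ∀ v, {e | r e = v}.Nonempty →
      d v = ⨆ e : {e // r e = v}, (dE e.1 : ℕ∞))
    (hinf : ∀ v, d v = ⊤ → ({e | r e = v} = ∅ ∨ {e | r e = v}.Infinite))
    (hrd : ∀ e, (dE e : ℕ∞) ≤ d (r e))
    (Sp : IDEdge E d → A) (Pp : IDVert d → A)
    (hfam : CKFamily (idRng r d dE hrd) (idSrc s d) Sp Pp) :
    ∀ (v w : V) (c : IDVert d) (μ ν : List (IDEdge E d)),
      IsPath (idRng r d dE hrd) (idSrc s d) (idVert0 d v) c μ →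
      IsPath (idRng r d dE hrd) (idSrc s d) (idVert0 d w) c ν →
      pathElt Sp Pp (idVert0 d v) μ * star (pathElt Sp Pp (idVert0 d w) ν) ∈
        (NonUnitalStarAlgebra.adjoin ℂ
          (Set.range (TID r d dE Sp) ∪ Set.range (QID d Pp))).topologicalClosure := by
  intro v w c μ ν hμ hν
  refine NonUnitalStarSubalgebra.le_topologicalClosure _ ?_
  have key := mul_mem (pathElt_mul_descentElt_mem hfam hμ)
    (star_mem (pathElt_mul_descentElt_mem hfam hν))
  rwa [star_mul, mul_assoc, ← mul_assoc (descentElt Sp Pp c), descentElt_mul_star hfam,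
    ← mul_assoc, hfam.pathElt_mul_proj hμ] at key
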